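/- The worst-case mean squared error of the distance perturbation mechanism M− converges to zero at rate Θ(exp(−ε/2)): with MSE(0) denoting the mean squared error at input 0, the limit of exp(ε/2)·MSE(0) as ε → ∞ equals 1/3; in particular there exist constants c₁, c₂ > 0 and ε₀ such that c₁·exp(−ε/2) ≤ MSE(0) ≤ c₂·exp(−ε/2) for all ε ≥ ε₀. -/

import Mathlib

open Real Filter

/-- The constant `C_ε` of the distance perturbation mechanism. -/
noncomputable def distC (ε : ℝ) : ℝ := (Real.exp (ε / 2) - 1) / (2 * Real.exp ε - 2)

/-- The sampling interval `[u, v)` of the distance perturbation mechanism `M−`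
with input `x`, given as the pair `(u, v)`. -/
noncomputable def distInterval (ε x : ℝ) : ℝ × ℝ :=
  if distC ε ≤ x ∧ x < 1 - distC ε then (x - distC ε, x + distC ε)
  else if 0 ≤ x ∧ x < distC ε then (0, 2 * distC ε)
  else (1 - 2 * distC ε, 1)

/-- Output density of the distance perturbation mechanism `M−` with input `x`. -/
noncomputable def distDensity (ε x y : ℝ) : ℝ :=
  if (distInterval ε x).1 ≤ y ∧ y < (distInterval ε x).2 then Real.exp (ε / 2)
  else Real.exp (ε / 2) / Real.exp ε

/-- Mean squared error of `M−` at input `x`. -/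
noncomputable def distMSE (ε x : ℝ) : ℝ := ∫ y in (0:ℝ)..1, (y - x) ^ 2 * distDensity ε x y

theorem exp_eq_exp_half_sq (ε : ℝ) : Real.exp ε = Real.exp (ε / 2) ^ 2 := by
  rw [← Real.exp_nat_mul]
  congr 1
  push_cast
  ring

theorem distC_eq {ε : ℝ} (hε : 0 < ε) : distC ε = 1 / (2 * (Real.exp (ε / 2) + 1)) := by
  have ht : 1 < Real.exp (ε / 2) := Real.one_lt_exp_iff.mpr (by linarith)
  rw [distC, exp_eq_exp_half_sq ε, div_eq_div_iff (by nlinarith) (by positivity)]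
  ring

theorem distInterval_zero {ε : ℝ} (hε : 0 < ε) : distInterval ε 0 = (0, 2 * distC ε) := by
  have hC : 0 < distC ε := by
    rw [distC_eq hε]
    positivity
  simp [distInterval, hC, hC.not_ge]

/-- The integral of a quadratic times a two-valued step function on `[0, 1]`. -/
theorem integral_sq_mul_step {a : ℝ} (ha₀ : 0 ≤ a) (ha₁ : a ≤ 1) (p q : ℝ) :
    ∫ y in (0 : ℝ)..1, y ^ 2 * (if 0 ≤ y ∧ y < a then p else q) =
      p * (a ^ 3 / 3) + q * ((1 - a ^ 3) / 3) := by
  have hleft : Set.EqOn (fun y : ℝ => y ^ 2 * p)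
      (fun y => y ^ 2 * (if 0 ≤ y ∧ y < a then p else q)) (Set.uIoo 0 a) := by
    intro y hy
    rw [Set.uIoo_of_le ha₀] at hy
    simp [hy.1.le, hy.2]
  have hright : Set.EqOn (fun y : ℝ => y ^ 2 * q)
      (fun y => y ^ 2 * (if 0 ≤ y ∧ y < a then p else q)) (Set.uIoo a 1) := by
    intro y hy
    rw [Set.uIoo_of_le ha₁] at hy
    simp [hy.1.not_gt]
  have hint (b c r : ℝ) :
      IntervalIntegrable (fun y : ℝ => y ^ 2 * r) MeasureTheory.volume b c :=
    Continuous.intervalIntegrable (by fun_prop) b c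
  rw [← intervalIntegral.integral_add_adjacent_intervals
      ((hint 0 a p).congr_uIoo hleft) ((hint a 1 q).congr_uIoo hright),
    ← intervalIntegral.integral_congr_uIoo hleft, ← intervalIntegral.integral_congr_uIoo hright,
    intervalIntegral.integral_mul_const, intervalIntegral.integral_mul_const,
    integral_pow, integral_pow]
  norm_num
  ring

theorem exp_half_mul_distMSE_zero {ε : ℝ} (hε : 0 < ε) :
    Real.exp (ε / 2) * distMSE ε 0 =
      1 / 3 + (Real.exp (ε / 2) - 1) / (3 * (Real.exp (ε / 2) + 1) ^ 2) := by
  have ht : 0 < Real.exp (ε / 2) := Real.exp_pos _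
  have ha : 2 * distC ε = 1 / (Real.exp (ε / 2) + 1) := by
    rw [distC_eq hε]
    field_simp
  have ha₁ : 1 / (Real.exp (ε / 2) + 1) ≤ 1 := by
    rw [div_le_one (by positivity)]
    linarith
  simp only [distMSE, distDensity, distInterval_zero hε, sub_zero, ha]
  rw [integral_sq_mul_step (by positivity) ha₁, exp_eq_exp_half_sq ε]
  field_simp
  ring

theorem exp_half_mul_distMSE_zero_bounds {ε : ℝ} (hε : 0 < ε) :
    1 / 3 ≤ Real.exp (ε / 2) * distMSE ε 0 ∧
      Real.exp (ε / 2) * distMSE ε 0 ≤ 1 / 3 + Real.exp (-ε / 2) / 3 := by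
  have ht : 1 < Real.exp (ε / 2) := Real.one_lt_exp_iff.mpr (by linarith)
  rw [exp_half_mul_distMSE_zero hε, neg_div, Real.exp_neg]
  set t := Real.exp (ε / 2)
  have ht₀ : 0 < t := by linarith
  constructor
  · have : 0 ≤ (t - 1) / (3 * (t + 1) ^ 2) := div_nonneg (by linarith) (by positivity)
    linarith
  · have : (t - 1) / (3 * (t + 1) ^ 2) ≤ t⁻¹ / 3 := by
      rw [inv_eq_one_div, div_div, div_le_div_iff₀ (by positivity) (by positivity)]
      nlinarith
    linarith

/-- The worst-case MSE of `M−` converges to zero at rate `Θ(exp(−ε/2))`: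
`exp(ε/2)·MSE(0) → 1/3` as `ε → ∞`, and in particular `MSE(0)` is sandwiched
between positive multiples of `exp(−ε/2)` for all large `ε`. -/
theorem dist_MSE_convergence_rate :
    Tendsto (fun ε : ℝ => Real.exp (ε / 2) * distMSE ε 0) atTop (nhds (1 / 3)) ∧
    ∃ c₁ c₂ ε₀ : ℝ, 0 < c₁ ∧ 0 < c₂ ∧
      ∀ ε : ℝ, ε₀ ≤ ε →
        c₁ * Real.exp (-ε / 2) ≤ distMSE ε 0 ∧
        distMSE ε 0 ≤ c₂ * Real.exp (-ε / 2) := by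
  constructor
  · have hexp : Tendsto (fun ε : ℝ => Real.exp (-ε / 2)) atTop (nhds 0) := by
      simp only [neg_div]
      exact Real.tendsto_exp_neg_atTop_nhds_zero.comp (tendsto_id.atTop_div_const two_pos)
    have hupper : Tendsto (fun ε : ℝ => 1 / 3 + Real.exp (-ε / 2) / 3) atTop (nhds (1 / 3)) := by
      simpa using (hexp.div_const 3).const_add (1 / 3 : ℝ)
    refine tendsto_of_tendsto_of_tendsto_of_le_of_le' tendsto_const_nhds hupper ?_ ?_
    · filter_upwards [eventually_gt_atTop 0] with ε hε
      exact (exp_half_mul_distMSE_zero_bounds hε).1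
    · filter_upwards [eventually_gt_atTop 0] with ε hε
      exact (exp_half_mul_distMSE_zero_bounds hε).2
  · refine ⟨1 / 3, 2 / 3, 1, by norm_num, by norm_num, fun ε hε => ?_⟩
    obtain ⟨hlower, hupper⟩ := exp_half_mul_distMSE_zero_bounds (ε := ε) (by linarith)
    have hle : Real.exp (-ε / 2) ≤ 1 := Real.exp_le_one_iff.mpr (by linarith)
    have ht : 0 < Real.exp (ε / 2) := Real.exp_pos _
    rw [neg_div, Real.exp_neg, ← div_eq_mul_inv, ← div_eq_mul_inv, div_le_iff₀' ht,
      le_div_iff₀' ht]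
    exact ⟨hlower, by linarith⟩
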